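/- For every polynomial f ∈ ℂ[z,w] in two complex variables, the set Cr_f of critical values of the map f : ℂ² → ℂ, i.e. the set {f(p) : p ∈ ℂ², ∂f/∂z(p) = 0 and ∂f/∂w(p) = 0}, is finite. -/

import Mathlib

/-- The set of critical values of a polynomial `f ∈ ℂ[z,w]`, viewed as a polynomial map
`ℂ² → ℂ`: the values `f(p)` at points `p` where both partial derivatives vanish. -/
def criticalValues (f : MvPolynomial (Fin 2) ℂ) : Set ℂ :=
  {v | ∃ p : Fin 2 → ℂ,
    MvPolynomial.eval p (MvPolynomial.pderiv 0 f) = 0 ∧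
    MvPolynomial.eval p (MvPolynomial.pderiv 1 f) = 0 ∧
    MvPolynomial.eval p f = v}

section

open Polynomial KaehlerDifferential TensorProduct

/-- In characteristic zero, an element of a finitely generated field extension whose Kähler
differential vanishes is algebraic over the base field. -/
theorem KaehlerDifferential.isAlgebraic_of_D_eq_zero {k K : Type*} [Field k] [CharZero k]
    [Field K] [Algebra k K] [Algebra.EssFiniteType k K] {x : K} (hx : D k K x = 0) :
    IsAlgebraic k x := by
  by_contra hx'
  let _ : Algebra k[X] K := (aeval (R := k) x).toAlgebra
  have : IsScalarTower k k[X] K := .of_algebraMap_eq' (aeval (R := k) x).comp_algebraMap.symm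
  have hinj : Function.Injective (algebraMap k[X] K) :=
    transcendental_iff_injective.mp hx'
  have : FaithfulSMul k[X] K := (faithfulSMul_iff_algebraMap_injective _ _).mpr hinj
  let _ : Algebra (FractionRing k[X]) K := FractionRing.liftAlgebra k[X] K
  have : IsScalarTower k[X] (FractionRing k[X]) K := FractionRing.isScalarTower_liftAlgebra _ _
  have : IsScalarTower k (FractionRing k[X]) K := .to₁₃₄ k k[X] _ _
  have : Algebra.EssFiniteType (FractionRing k[X]) K := .of_comp k _ K
  have : Algebra.FormallySmooth k[X] (FractionRing k[X]) :=
    .of_isLocalization (nonZeroDivisors k[X])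
  have : Algebra.FormallySmooth k[X] K := .comp _ (FractionRing k[X]) _
  have hD : mapBaseChange k k[X] K (1 ⊗ₜ D k k[X] X) = 0 := by
    rw [mapBaseChange_tmul, map_D, one_smul]
    convert hx
    exact aeval_X x
  obtain ⟨y, hy⟩ := (Algebra.H1Cotangent.exact_δ_mapBaseChange k k[X] K _).mp hD
  rw [Subsingleton.elim y 0, map_zero] at hy
  have := congr((LinearMap.lTensor K (polynomialEquiv k).toLinearMap) $hy)
  have := congr(TensorProduct.rid k[X] K $this)
  simp [polynomialEquiv_D] at this

/-- If all partial derivatives of `f` lie in a prime ideal `P`, then `f` is constant modulo `P`. -/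
theorem MvPolynomial.exists_sub_C_mem_of_pderiv_mem {k σ : Type*} [Field k] [CharZero k]
    [IsAlgClosed k] [Finite σ] {f : MvPolynomial σ k} (P : Ideal (MvPolynomial σ k)) [P.IsPrime]
    (hf : ∀ i, pderiv i f ∈ P) : ∃ c : k, f - C c ∈ P := by
  have := Fintype.ofFinite σ
  let K := FractionRing (MvPolynomial σ k ⧸ P)
  have hmem (g : MvPolynomial σ k) : algebraMap (MvPolynomial σ k) K g = 0 ↔ g ∈ P := by
    rw [IsScalarTower.algebraMap_apply _ (MvPolynomial σ k ⧸ P) K,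
      FaithfulSMul.algebraMap_eq_zero_iff, Ideal.Quotient.algebraMap_eq,
      Ideal.Quotient.eq_zero_iff_mem]
  have hD : D k K (algebraMap (MvPolynomial σ k) K f) = 0 := by
    rw [← map_D k k, ← (mvPolynomialBasis k σ).sum_repr (D k _ f), map_sum]
    refine Finset.sum_eq_zero fun i _ ↦ ?_
    rw [mvPolynomialBasis_repr_apply, map_smul, ← algebraMap_smul K, (hmem _).mpr (hf i), zero_smul]
  obtain ⟨c, hc⟩ := minpoly.mem_range_of_degree_eq_one k _
    (IsAlgClosed.degree_eq_one_of_irreducible k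
      (minpoly.irreducible (isAlgebraic_of_D_eq_zero hD).isIntegral))
  refine ⟨c, (hmem _).mp ?_⟩
  rw [map_sub, ← hc, ← MvPolynomial.algebraMap_eq, ← IsScalarTower.algebraMap_apply, sub_self]

end

/-- For every polynomial `f ∈ ℂ[z,w]`, the set of critical values of `f : ℂ² → ℂ`
is finite. -/
theorem criticalValues_finite (f : MvPolynomial (Fin 2) ℂ) :
    (criticalValues f).Finite := by
  let I : Ideal (MvPolynomial (Fin 2) ℂ) :=
    Ideal.span {MvPolynomial.pderiv 0 f, MvPolynomial.pderiv 1 f}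
  have hI : ∀ P ∈ I.minimalPrimes, ∃ c : ℂ, f - MvPolynomial.C c ∈ P := fun P hP ↦ by
    have : P.IsPrime := hP.1.1
    refine MvPolynomial.exists_sub_C_mem_of_pderiv_mem P (Fin.forall_fin_two.mpr ⟨?_, ?_⟩) <;>
      exact hP.1.2 (Ideal.subset_span (by simp))
  choose! c hc using hI
  refine ((I.finite_minimalPrimes_of_isNoetherianRing _).image c).subset ?_
  rintro _ ⟨p, h0, h1, rfl⟩
  have hle : I ≤ RingHom.ker (MvPolynomial.eval p) := by
    rw [Ideal.span_le]
    rintro _ (rfl | rfl)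
    exacts [h0, h1]
  have := RingHom.ker_isPrime (MvPolynomial.eval p)
  obtain ⟨P, hP, hPp⟩ := Ideal.exists_minimalPrimes_le hle
  refine ⟨P, hP, ?_⟩
  have := hPp (hc P hP)
  rw [RingHom.mem_ker, map_sub, MvPolynomial.eval_C, sub_eq_zero] at this
  exact this.symm
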